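/- Let G=(V,E) be a finite directed graph without self-loops, parallel edges, or directed cycles, with distinct vertices s,t ∈ V such that every edge incident to s is outgoing from s and every edge incident to t is incoming to t (dead-end vertices are allowed), and let c : E → L be a capacity function into a distributive lattice L having a least element ⊥. Then ⋁_{P∈𝒫} ⋀_{e∈P} c(e) = ⋀_{C∈𝒞} ⋁_{e crossing C} c(e), where empty joins are interpreted as ⊥; in particular, if there is no s–t path then both sides equal ⊥. -/

import Mathlib

open Classical

/-- A directed `s`–`t` path in the digraph with edge relation `E`: a list of
pairwise-distinct vertices beginning at `s`, ending at `t`, whose consecutive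
pairs are edges. -/
def IsSTPath {V : Type*} (E : V → V → Prop) (s t : V) (p : List V) : Prop :=
  p.Chain' E ∧ p.head? = some s ∧ p.getLast? = some t ∧ p.Nodup

/-- The list of (directed) edges traversed by a path, i.e. its consecutive pairs. -/
def pathEdges {V : Type*} (p : List V) : List (V × V) := p.zip p.tail

/-- The (finite) set of `s`–`t` paths, encoded as nodup vertex lists. -/
noncomputable def pathFinset {V : Type*} [Fintype V] (E : V → V → Prop) (s t : V) :
    Finset {l : List V // l.Nodup} :=
  Finset.univ.filter (fun p => IsSTPath E s t p.1)

/-- The (finite) set of `s`–`t` cuts, encoded by the source side `S` (the sink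
side being its complement). -/
noncomputable def cutFinset {V : Type*} [Fintype V] (s t : V) : Finset (Finset V) :=
  Finset.univ.filter (fun S => s ∈ S ∧ t ∉ S)

/-- The edges crossing the cut with source side `S`. -/
noncomputable def crossEdges {V : Type*} [Fintype V] (E : V → V → Prop) (S : Finset V) :
    Finset (V × V) :=
  Finset.univ.filter (fun e => E e.1 e.2 ∧ e.1 ∈ S ∧ e.2 ∉ S)

/-- Join of `f` over a finite set of edges; the junk value `j` is used only when the
set is empty (which never happens in the situations considered). -/
noncomputable def joinOver {V L : Type*} [Lattice L] (f : V → V → L) (S : Finset (V × V))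
    (j : L) : L :=
  if h : S.Nonempty then S.sup' h (fun e => f e.1 e.2) else j

/-- Meet of `f` over a finite set of edges; the junk value `j` is used only when the
set is empty (which never happens in the situations considered). -/
noncomputable def meetOver {V L : Type*} [Lattice L] (f : V → V → L) (S : Finset (V × V))
    (j : L) : L :=
  if h : S.Nonempty then S.inf' h (fun e => f e.1 e.2) else j

/-- The bottleneck value of a path: the meet of the capacities of its edges. -/
noncomputable def pathMeet {V L : Type*} [Lattice L] (c : V → V → L) (j : L) (p : List V) : L :=
  meetOver c (pathEdges p).toFinset j

/-- The capacity of a cut: the join of the capacities of the edges crossing it. -/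
noncomputable def cutJoin {V L : Type*} [Fintype V] [Lattice L] (E : V → V → Prop)
    (c : V → V → L) (j : L) (S : Finset V) : L :=
  joinOver c (crossEdges E S) j

/-- There is always at least one `s`–`t` cut (e.g. `S = {s}`). -/
lemma cutFinset_nonempty {V : Type*} [Fintype V] {s t : V} (h : s ≠ t) :
    (cutFinset s t).Nonempty :=
  ⟨{s}, by simp [cutFinset, Ne.symm h]⟩

/-- A source–target network possibly with dead ends: a finite digraph (edges given by
a relation, hence no parallel edges) without self-loops or directed cycles, with
distinct source `s` and sink `t`, all edges at `s` outgoing and all edges at `t`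
incoming; no connectivity is assumed. -/
structure IsSTNetwork {V : Type*} (E : V → V → Prop) (s t : V) : Prop where
  no_self_loop : ∀ v, ¬ E v v
  acyclic : ∀ v, ¬ Relation.TransGen E v v
  ne : s ≠ t
  source_out : ∀ v, ¬ E v s
  sink_in : ∀ v, ¬ E t v

/-- A path leaving `S` traverses an edge crossing `S`. -/
lemma exists_mem_pathEdges_crossing {V : Type*} {r : V → V → Prop} {S : Finset V} {t : V}
    (ht : t ∉ S) : ∀ {p : List V} {s : V}, p.IsChain r → p.head? = some s →
      p.getLast? = some t → s ∈ S → ∃ e ∈ pathEdges p, r e.1 e.2 ∧ e.1 ∈ S ∧ e.2 ∉ S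
  | [], _, _, hs, _, _ => by simp at hs
  | [a], _, _, hs, hl, hS => by
    simp only [List.head?_cons, List.getLast?_singleton, Option.some.injEq] at hs hl
    subst hs hl
    exact absurd hS ht
  | a :: b :: l, _, hc, hs, hl, hS => by
    simp only [List.head?_cons, Option.some.injEq] at hs
    subst hs
    rw [List.isChain_cons_cons] at hc
    by_cases hb : b ∈ S
    · obtain ⟨e, he, h⟩ := exists_mem_pathEdges_crossing ht (p := b :: l) hc.2 rfl
        (by simpa using hl) hb
      exact ⟨e, by simpa [pathEdges] using Or.inr he, h⟩
    · exact ⟨(a, b), by simp [pathEdges], hc.1, hS, hb⟩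

/-- The traversed edges of a chain satisfy its relation. -/
lemma rel_of_mem_pathEdges {V : Type*} {r : V → V → Prop} :
    ∀ {p : List V}, p.IsChain r → ∀ e ∈ pathEdges p, r e.1 e.2
  | [], _, e, he => by simp [pathEdges] at he
  | [a], _, e, he => by simp [pathEdges] at he
  | a :: b :: l, hc, e, he => by
    rw [List.isChain_cons_cons] at hc
    simp only [pathEdges, List.tail_cons, List.zip_cons_cons, List.mem_cons] at he
    rcases he with rfl | he
    · exact hc.1
    · exact rel_of_mem_pathEdges (p := b :: l) hc.2 e (by simpa [pathEdges] using he)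

/-- In an acyclic digraph every chain of edges has distinct vertices. -/
lemma nodup_of_isChain_of_acyclic {V : Type*} {r : V → V → Prop}
    (hr : ∀ v, ¬ Relation.TransGen r v v) {p : List V} (hp : p.IsChain r) : p.Nodup := by
  have h : p.Pairwise (Relation.TransGen r) :=
    List.isChain_iff_pairwise.1 (hp.imp fun _ _ => Relation.TransGen.single)
  refine h.imp ?_
  rintro a _ hab rfl
  exact hr a hab

/-- In a distributive lattice, `a ≤ b` as soon as every prime ideal containing `b`
contains `a`. -/
lemma le_of_forall_isPrime_mem {L : Type*} [DistribLattice L] {a b : L}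
    (h : ∀ J : Order.Ideal L, J.IsPrime → b ∈ J → a ∈ J) : a ≤ b := by
  by_contra hab
  obtain ⟨J, hJ, hbJ, hdisj⟩ := DistribLattice.prime_ideal_of_disjoint_filter_ideal
    (F := Order.PFilter.principal a) (I := Order.Ideal.principal b) <| by
      rw [Set.disjoint_left]
      intro x hax hxb
      exact hab ((Order.PFilter.mem_principal.1 hax).trans (Order.Ideal.mem_principal.1 hxb))
  exact Set.disjoint_left.1 hdisj (Order.PFilter.mem_principal.2 le_rfl)
    (h J hJ (hbJ (Order.Ideal.mem_principal.2 le_rfl)))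

/-- A prime ideal containing a finite nonempty meet contains one of its terms. -/
lemma exists_mem_of_inf'_mem {ι L : Type*} [Lattice L] {J : Order.Ideal L} (hJ : J.IsPrime)
    {S : Finset ι} (hS : S.Nonempty) {f : ι → L} (h : S.inf' hS f ∈ J) : ∃ i ∈ S, f i ∈ J := by
  by_contra! hf
  exact Finset.inf'_induction (p := (· ∉ J)) hS f
    (fun a ha b hb hab => (hJ.mem_or_mem hab).elim ha hb) hf h

/-- **Bottleneck duality with dead ends.** For a source–target network (dead-end
vertices allowed) with capacities in a distributive lattice with least element `⊥`,
the join over all `s`–`t` paths of the path bottlenecks equals the meet over all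
`s`–`t` cuts of the joins of the crossing-edge capacities, where empty joins are `⊥`
(`Finset.sup`); in particular both sides are `⊥` when there is no `s`–`t` path.
(Each path has at least one edge since `s ≠ t`, so the junk value of `pathMeet` is
never used.) -/
theorem bottleneck_duality_with_dead_ends {V L : Type*} [Fintype V]
    [DistribLattice L] [OrderBot L]
    (E : V → V → Prop) (s t : V) (hG : IsSTNetwork E s t) (c : V → V → L) :
    (pathFinset E s t).sup (fun p => pathMeet c ⊥ p.1) =
      (cutFinset s t).inf' (cutFinset_nonempty hG.ne)
        (fun S => (crossEdges E S).sup (fun e => c e.1 e.2)) := by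
  have ne_nil : ∀ p, IsSTPath E s t p → (pathEdges p).toFinset.Nonempty := by
    rintro p ⟨hc, hs, hl, -⟩
    obtain ⟨e, he, -⟩ := exists_mem_pathEdges_crossing (S := {s}) (by simpa using hG.ne.symm)
      hc hs hl (by simp)
    exact ⟨e, List.mem_toFinset.2 he⟩
  apply le_antisymm
  · refine Finset.sup_le fun p hp => Finset.le_inf' _ _ fun S hS => ?_
    have hp : IsSTPath E s t p.1 := by simpa [pathFinset] using hp
    have hS : s ∈ S ∧ t ∉ S := by simpa [cutFinset] using hS
    obtain ⟨e, he, hcross⟩ := exists_mem_pathEdges_crossing hS.2 hp.1 hp.2.1 hp.2.2.1 hS.1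
    rw [pathMeet, meetOver, dif_pos (ne_nil _ hp)]
    have hmem : e ∈ crossEdges E S := by simpa [crossEdges] using hcross
    exact (Finset.inf'_le (fun e : V × V => c e.1 e.2) (List.mem_toFinset.2 he)).trans
      (Finset.le_sup (f := fun e : V × V => c e.1 e.2) hmem)
  · refine le_of_forall_isPrime_mem fun J hJ hJmem => ?_
    rw [Order.Ideal.finsetSup_mem_iff] at hJmem
    let r : V → V → Prop := fun u v => E u v ∧ c u v ∉ J
    by_cases hst : Relation.ReflTransGen r s t
    · obtain ⟨l, hl, hlast⟩ := List.exists_isChain_cons_of_relationReflTransGen hst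
      have hE : (s :: l).IsChain E := hl.imp fun _ _ h => h.1
      have hnd := nodup_of_isChain_of_acyclic hG.acyclic hE
      have hp : IsSTPath E s t (s :: l) :=
        ⟨hE, rfl, by rw [List.getLast?_eq_some_getLast (List.cons_ne_nil _ _), hlast], hnd⟩
      have hmem := hJmem ⟨s :: l, hnd⟩ (by simpa [pathFinset] using hp)
      rw [pathMeet, meetOver, dif_pos (ne_nil _ hp)] at hmem
      obtain ⟨e, he, heJ⟩ := exists_mem_of_inf'_mem hJ _ hmem
      exact absurd heJ (rel_of_mem_pathEdges hl e (List.mem_toFinset.1 he)).2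
    · let S : Finset V := Finset.univ.filter (Relation.ReflTransGen r s)
      have hS : S ∈ cutFinset s t := by
        simpa [cutFinset, S] using ⟨Relation.ReflTransGen.refl, hst⟩
      refine J.lower (Finset.inf'_le _ hS) ((Order.Ideal.finsetSup_mem_iff J).2 fun e he => ?_)
      simp only [crossEdges, S, Finset.mem_filter, Finset.mem_univ, true_and] at he
      by_contra heJ
      exact he.2.2 (he.2.1.tail ⟨he.1, heJ⟩)
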